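/- (Theorem 5, from [CGW07]) Let U ⊆ ℝⁿ be an unbounded open set whose boundary ∂U is bounded and nonempty. Let u, v be continuous on the closure of U, with u infinity subharmonic in U (u satisfies comparison with cones from above) and v infinity superharmonic in U (v satisfies comparison with cones from below). Assume limsup_{x→∞} u(x)/|x| ≤ 0 and liminf_{x→∞} v(x)/|x| ≥ 0. Then u(x) − v(x) ≤ max_{∂U}(u − v) for all x ∈ U. -/

import Mathlib

open Metric Set Filter Bornology Topology
open scoped RealInnerProductSpace

noncomputable section

/-- Euclidean space ℝⁿ. -/
abbrev Euc (n : ℕ) := EuclideanSpace ℝ (Fin n)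

/-- Comparison with cones from above (infinity subharmonic). -/
def CmpAbove {n : ℕ} (Ω : Set (Euc n)) (u : Euc n → ℝ) : Prop :=
  ∀ V : Set (Euc n), IsOpen V → IsBounded V → closure V ⊆ Ω →
    ∀ (x₀ : Euc n) (a b : ℝ),
      (∀ x ∈ frontier (V \ {x₀}), u x ≤ a * ‖x - x₀‖ + b) →
      ∀ x ∈ V, u x ≤ a * ‖x - x₀‖ + b

/-- Comparison with cones from below (infinity superharmonic). -/
def CmpBelow {n : ℕ} (Ω : Set (Euc n)) (u : Euc n → ℝ) : Prop :=
  ∀ V : Set (Euc n), IsOpen V → IsBounded V → closure V ⊆ Ω →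
    ∀ (x₀ : Euc n) (a b : ℝ),
      (∀ x ∈ frontier (V \ {x₀}), a * ‖x - x₀‖ + b ≤ u x) →
      ∀ x ∈ V, a * ‖x - x₀‖ + b ≤ u x

/-- Infinity harmonic = comparison with cones from both sides. -/
def InfHarmonic {n : ℕ} (Ω : Set (Euc n)) (u : Euc n → ℝ) : Prop :=
  CmpAbove Ω u ∧ CmpBelow Ω u

/-- m⁺ = max of u on ∂Ω. -/
def mP {n : ℕ} (Ω : Set (Euc n)) (u : Euc n → ℝ) : ℝ := sSup (u '' frontier Ω)

/-- m⁻ = min of u on ∂Ω. -/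
def mM {n : ℕ} (Ω : Set (Euc n)) (u : Euc n → ℝ) : ℝ := sInf (u '' frontier Ω)

/-- S⁺_r := (max(max_{∂B_r} u, m⁺) − m⁺)/r. -/
def SP {n : ℕ} (Ω : Set (Euc n)) (u : Euc n → ℝ) (r : ℝ) : ℝ :=
  (max (sSup (u '' sphere (0 : Euc n) r)) (mP Ω u) - mP Ω u) / r

/-- S⁻_r := (m⁻ − min(min_{∂B_r} u, m⁻))/r. -/
def SM {n : ℕ} (Ω : Set (Euc n)) (u : Euc n → ℝ) (r : ℝ) : ℝ :=
  (mM Ω u - min (sInf (u '' sphere (0 : Euc n) r)) (mM Ω u)) / r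

/-- Lip(u, S) := sup_{x≠y ∈ S} |u(x) − u(y)|/|x − y|. -/
def lipOn {n : ℕ} (u : Euc n → ℝ) (S : Set (Euc n)) : ℝ :=
  sSup ((fun p : Euc n × Euc n => |u p.1 - u p.2| / ‖p.1 - p.2‖) ''
    {p : Euc n × Euc n | p.1 ∈ S ∧ p.2 ∈ S ∧ p.1 ≠ p.2})

/-- `AscendsAt r f x`: among the `r`-neighbours of `x` there is one maximising `f`, and the largest
descent of `f` from `x` to a neighbour is at most its largest ascent. -/
def AscendsAt {X : Type*} (r : X → X → Prop) (f : X → ℝ) (x : X) : Prop :=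
  ∃ z, r x z ∧ (∀ y, r x y → f y ≤ f z) ∧ ∀ y, r x y → f x - f y ≤ f z - f x

/-- Values `f z - k * γ`, where `z` is the exit point of an `r`-chain from `x` which makes `k` steps
in `V` before leaving it. -/
inductive ExitValue {X : Type*} (r : X → X → Prop) (f : X → ℝ) (γ : ℝ) (V : Set X) : X → ℝ → Prop
  | leave (x : X) : x ∉ V → ExitValue r f γ V x (f x)
  | step (x y : X) (t : ℝ) : x ∈ V → r x y → ExitValue r f γ V y t → ExitValue r f γ V x (t - γ)

/-- The set of points of `I` at which the largest ascent of `f` is less than `γ`. -/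
def flatSet {X : Type*} (r : X → X → Prop) (f : X → ℝ) (γ : ℝ) (I : Set X) : Set X :=
  {x | x ∈ I ∧ ∀ y, r x y → f y < f x + γ}

/-- The function `f`, replaced on its flat set by the largest exit value. -/
def steepen {X : Type*} (r : X → X → Prop) (f : X → ℝ) (γ : ℝ) (I : Set X) (x : X) : ℝ :=
  sSup {t | ExitValue r f γ (flatSet r f γ I) x t}

section Discrete

variable {X : Type*} {r : X → X → Prop} {f g : X → ℝ} {γ : ℝ} {I D : Set X}

lemma ExitValue.eq_of_notMem {V : Set X} {x : X} {t : ℝ} (h : ExitValue r f γ V x t)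
    (hx : x ∉ V) : t = f x := by
  cases h with
  | leave => rfl
  | step _ _ _ hV => exact absurd hV hx

lemma steepen_of_notMem {x : X} (hx : x ∉ flatSet r f γ I) : steepen r f γ I x = f x := by
  have : {t | ExitValue r f γ (flatSet r f γ I) x t} = {f x} := by
    ext t
    constructor
    · intro h
      exact ExitValue.eq_of_notMem h hx
    · rintro rfl
      exact ExitValue.leave x hx
  rw [steepen, this, csSup_singleton]

lemma ExitValue.le {x : X} {t : ℝ} (h : ExitValue r f γ (flatSet r f γ I) x t) : t ≤ f x := by
  induction h with
  | leave => exact le_rfl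
  | step x y t hx hxy _ ih => linarith [hx.2 y hxy]

lemma ExitValue.le_steepen {x : X} {t : ℝ} (h : ExitValue r f γ (flatSet r f γ I) x t) :
    t ≤ steepen r f γ I x :=
  le_csSup ⟨f x, fun _ hs => ExitValue.le hs⟩ h

lemma exists_exitValue (hγ : 0 ≤ γ) (hf : ∀ x ∈ I, AscendsAt r f x) (ρ : X → ℕ)
    (hρ : ∀ x ∈ I, ∃ y, r x y ∧ ρ y < ρ x) (x : X) :
    ∃ t, ExitValue r f γ (flatSet r f γ I) x t ∧ f x - 2 * ρ x * γ ≤ t := by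
  induction hk : ρ x using Nat.strong_induction_on generalizing x with
  | _ k ih =>
  by_cases hx : x ∈ flatSet r f γ I
  · obtain ⟨y, hxy, hy⟩ := hρ x hx.1
    obtain ⟨t, ht, hle⟩ := ih (ρ y) (hk ▸ hy) y rfl
    refine ⟨t - γ, .step x y t hx hxy ht, ?_⟩
    obtain ⟨z, hz, -, hz'⟩ := hf x hx.1
    have h1 := hz' y hxy
    have h2 := hx.2 z hz
    have h3 : (ρ y : ℝ) + 1 ≤ k := by exact_mod_cast hk ▸ hy
    nlinarith
  · exact ⟨f x, .leave x hx, by nlinarith [mul_nonneg (Nat.cast_nonneg (α := ℝ) k) hγ]⟩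

lemma steepen_le {x : X} (hne : ∃ t, ExitValue r f γ (flatSet r f γ I) x t) : steepen r f γ I x ≤ f x :=
  csSup_le hne fun _ ht => ExitValue.le ht

/-- The steepened function still ascends at least as much as it descends, and ascends by at least
`γ` (up to an arbitrarily small error). -/
lemma exists_slope_steepen (hr : ∀ x y, r x y → r y x) (hf : ∀ x ∈ I, AscendsAt r f x)
    (hne : ∀ x, ∃ t, ExitValue r f γ (flatSet r f γ I) x t) {x : X} (hx : x ∈ I) :
    ∃ T, γ ≤ T ∧ (∀ y, r x y → steepen r f γ I x - T ≤ steepen r f γ I y) ∧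
      ∀ η > 0, ∃ z, r x z ∧ steepen r f γ I x + T - η ≤ steepen r f γ I z := by
  obtain ⟨z, hxz, hmax, hz⟩ := hf x hx
  by_cases hxV : x ∈ flatSet r f γ I
  · refine ⟨γ, le_rfl, fun y hxy => ?_, fun η hη => ?_⟩
    · by_cases hyV : y ∈ flatSet r f γ I
      · rw [sub_le_iff_le_add]
        refine csSup_le (hne x) fun t ht => ?_
        have := (ExitValue.step y x t hyV (hr _ _ hxy) ht).le_steepen
        linarith
      · rw [steepen_of_notMem hyV]
        linarith [hz y hxy, hxV.2 z hxz, steepen_le (hne x)]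
    · obtain ⟨t, ht, hlt⟩ := exists_lt_of_lt_csSup (hne x)
        (show steepen r f γ I x - η < steepen r f γ I x by linarith)
      cases ht with
      | leave _ h => exact absurd hxV h
      | step _ y t _ hxy hy => exact ⟨y, hxy, by linarith [hy.le_steepen]⟩
  · obtain ⟨w, hxw, hw⟩ : ∃ w, r x w ∧ f x + γ ≤ f w := by
      by_contra! h
      exact hxV ⟨hx, h⟩
    have hγz : γ ≤ f z - f x := by linarith [hmax w hxw]
    have hzV : z ∉ flatSet r f γ I := fun hzV => by
      obtain ⟨z', hzz', -, hz'⟩ := hf z hzV.1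
      linarith [hz' x (hr _ _ hxz), hzV.2 z' hzz']
    refine ⟨f z - f x, hγz, fun y hxy => ?_, fun η hη => ⟨z, hxz, ?_⟩⟩
    · rw [steepen_of_notMem hxV]
      by_cases hyV : y ∈ flatSet r f γ I
      · have := (ExitValue.step y x (f x) hyV (hr _ _ hxy) (.leave x hxV)).le_steepen
        linarith
      · rw [steepen_of_notMem hyV]
        linarith [hz y hxy]
    · rw [steepen_of_notMem hxV, steepen_of_notMem hzV]
      linarith

/-- Comparison principle for functions with a positive lower bound on the ascent; no attainment
of suprema is required. -/
lemma sub_le_of_slope {c C m : ℝ} (hγ : 0 < γ) (hID : ∀ x ∈ I, ∀ y, r x y → y ∈ D)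
    (hf : ∀ x ∈ I, ∃ T, γ ≤ T ∧ (∀ y, r x y → f x - T ≤ f y) ∧
      ∀ η > 0, ∃ z, r x z ∧ f x + T - η ≤ f z)
    (hg : ∀ x ∈ I, AscendsAt r (fun y => -g y) x)
    (hfC : ∀ x ∈ D, f x ≤ C) (hgc : ∀ x ∈ D, c ≤ g x)
    (hm : ∀ x ∈ D, x ∉ I → f x - g x ≤ m) {x : X} (hx : x ∈ D) : f x - g x ≤ m := by
  set S : Set ℝ := (fun y => f y - g y) '' D
  have hbdd : BddAbove S := ⟨C - c, by
    rintro _ ⟨y, hy, rfl⟩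
    linarith [hfC y hy, hgc y hy]⟩
  have hle : ∀ y ∈ D, f y - g y ≤ sSup S := fun y hy => le_csSup hbdd ⟨y, hy, rfl⟩
  by_contra! hlt
  have hM : m < sSup S := hlt.trans_le (hle x hx)
  have key : ∀ N : ℕ, ∀ y ∈ D, ∀ δ > 0, sSup S - δ ≤ f y - g y → 3 ^ N * δ < sSup S - m →
      f y + N * (γ / 2) ≤ C := by
    intro N
    induction N with
    | zero =>
      intro y hy δ _ _ _
      simpa using hfC y hy
    | succ N ih =>
      intro y hy δ hδ hyδ hN
      have hpow : (1 : ℝ) ≤ 3 ^ (N + 1) := one_le_pow₀ (by norm_num)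
      have hyI : y ∈ I := by
        by_contra hyI
        nlinarith [hm y hy hyI]
      obtain ⟨T, hT, hlow, hup⟩ := hf y hyI
      obtain ⟨w, hyw, -, hw⟩ := hg y hyI
      obtain ⟨z, hyz, hz⟩ := hup (min (γ / 2) δ) (lt_min (by linarith) hδ)
      have h1 := min_le_left (γ / 2) δ
      have h2 := min_le_right (γ / 2) δ
      have h3 := hw z hyz
      have h4 := hlow w hyw
      have h5 := hle w (hID y hyI w hyw)
      have h6 := ih z (hID y hyI z hyz) (3 * δ) (by linarith) (by linarith)
        (by rw [pow_succ] at hN; linarith)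
      push_cast
      linarith
  obtain ⟨N, hN⟩ := exists_nat_gt ((C - c - m) / (γ / 2))
  rw [div_lt_iff₀ (by linarith)] at hN
  have hpow : (1 : ℝ) ≤ 3 ^ N := one_le_pow₀ (by norm_num)
  have hpos : 0 < (sSup S - m) / (2 * 3 ^ N) := div_pos (by linarith) (by positivity)
  obtain ⟨_, ⟨y, hy, rfl⟩, hyδ⟩ := exists_lt_of_lt_csSup (⟨_, x, hx, rfl⟩ : S.Nonempty)
    (show sSup S - (sSup S - m) / (2 * 3 ^ N) < sSup S by linarith)
  have hmul : 3 ^ N * ((sSup S - m) / (2 * 3 ^ N)) = (sSup S - m) / 2 := by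
    field_simp
  have := key N y hy _ hpos hyδ.le (by linarith)
  have hsmall : (sSup S - m) / (2 * 3 ^ N) ≤ (sSup S - m) / 2 := by
    rw [← hmul]
    exact le_mul_of_one_le_left hpos.le hpow
  simp only at hyδ
  linarith [hgc y hy]

/-- Comparison principle on a graph, for bounded functions, without compactness. -/
lemma sub_le_of_ascendsAt {c C m : ℝ} (hr : ∀ x y, r x y → r y x)
    (hID : ∀ x ∈ I, ∀ y, r x y → y ∈ D) (ρ : X → ℕ) (hρ : ∀ x ∈ I, ∃ y, r x y ∧ ρ y < ρ x)
    (hf : ∀ x ∈ I, AscendsAt r f x) (hg : ∀ x ∈ I, AscendsAt r (fun y => -g y) x)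
    (hfC : ∀ x ∈ D, f x ≤ C) (hgc : ∀ x ∈ D, c ≤ g x)
    (hm : ∀ x ∈ D, x ∉ I → f x - g x ≤ m) {x : X} (hx : x ∈ D) : f x - g x ≤ m := by
  have key : ∀ γ > 0, f x - g x ≤ m + γ * (2 * ρ x) := by
    intro γ hγ
    have hne : ∀ y, ∃ t, ExitValue r f γ (flatSet r f γ I) y t := fun y =>
      (exists_exitValue hγ.le hf ρ hρ y).imp fun _ h => h.1
    obtain ⟨t, ht, hxt⟩ := exists_exitValue hγ.le hf ρ hρ x
    have := sub_le_of_slope (f := steepen r f γ I) (m := m) hγ hID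
      (fun y hy => exists_slope_steepen hr hf hne hy) hg
      (fun y hy => (steepen_le (hne y)).trans (hfC y hy)) hgc
      (fun y hy hyI => by linarith [steepen_le (hne y), hm y hy hyI]) hx
    linarith [ht.le_steepen]
  have hlim : Tendsto (fun γ : ℝ => m + γ * (2 * ρ x)) (𝓝[>] 0) (𝓝 m) := by
    have : Continuous fun γ : ℝ => m + γ * (2 * ρ x) := by fun_prop
    simpa using (this.tendsto 0).mono_left nhdsWithin_le_nhds
  exact ge_of_tendsto hlim (eventually_mem_nhdsWithin.mono fun γ hγ => key γ hγ)

end Discrete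

section Continuous

variable {n : ℕ} {U : Set (Euc n)} {u v : Euc n → ℝ}

lemma CmpBelow.neg (h : CmpBelow U v) : CmpAbove U (fun x => -v x) := by
  intro V hV hb hc x₀ a b hfr x hx
  have := h V hV hb hc x₀ (-a) (-b) (fun y hy => by linarith [hfr y hy]) x hx
  linarith

/-- The maximum of `u` over the closed ball of radius `ε`. -/
def ballMax {n : ℕ} (ε : ℝ) (u : Euc n → ℝ) (x : Euc n) : ℝ := sSup (u '' closedBall x ε)

lemma exists_eq_ballMax {ε : ℝ} (hε : 0 ≤ ε) {x : Euc n} (hu : ContinuousOn u (closedBall x ε)) :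
    ∃ y ∈ closedBall x ε, ballMax ε u x = u y := by
  obtain ⟨y, hy, h, -⟩ := (isCompact_closedBall x ε).exists_sSup_image_eq_and_ge
    ⟨x, mem_closedBall_self hε⟩ hu
  exact ⟨y, hy, h⟩

lemma le_ballMax {ε : ℝ} {x y : Euc n} (hu : ContinuousOn u (closedBall x ε))
    (hy : y ∈ closedBall x ε) : u y ≤ ballMax ε u x :=
  le_csSup ((isCompact_closedBall x ε).image_of_continuousOn hu).bddAbove ⟨y, hy, rfl⟩

/-- Comparison with a cone centred at the centre of a ball. -/
lemma CmpAbove.le_of_mem_closedBall (h : CmpAbove U u) {ε M : ℝ} (hε : 0 < ε) {x y : Euc n}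
    (hU : closedBall x (2 * ε) ⊆ U) (hM : ∀ z ∈ closedBall x (2 * ε), u z ≤ M)
    (hy : y ∈ closedBall x ε) : 2 * u y ≤ u x + M := by
  have hx : u x ≤ M := hM x (mem_closedBall_self (by linarith))
  have hcone := h (ball x (2 * ε)) isOpen_ball isBounded_ball
    (closure_ball_subset_closedBall.trans hU) x ((M - u x) / (2 * ε)) (u x) ?_ y
    (closedBall_subset_ball (by linarith) hy)
  · have hd : ‖y - x‖ ≤ ε := by simpa [dist_eq_norm] using hy
    have : (M - u x) / (2 * ε) * ‖y - x‖ ≤ (M - u x) / (2 * ε) * ε :=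
      mul_le_mul_of_nonneg_left hd (div_nonneg (by linarith) (by linarith))
    have h2 : (M - u x) / (2 * ε) * ε = (M - u x) / 2 := by field_simp
    linarith
  · intro z hz
    by_cases hzx : z = x
    · simp [hzx]
    have hopen : IsOpen (ball x (2 * ε) \ {x}) := isOpen_ball.sdiff isClosed_singleton
    rw [hopen.frontier_eq] at hz
    have hz1 : z ∈ closedBall x (2 * ε) :=
      closure_ball_subset_closedBall (closure_mono sdiff_subset hz.1)
    have hz2 : ‖z - x‖ = 2 * ε := by
      refine le_antisymm (by simpa [dist_eq_norm] using hz1) ?_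
      by_contra! hlt
      exact hz.2 ⟨by simpa [dist_eq_norm] using hlt, hzx⟩
    rw [hz2, div_mul_cancel₀ _ (by positivity)]
    linarith [hM z hz1]

lemma CmpAbove.ascendsAt_ballMax (h : CmpAbove U u) (hu : ContinuousOn u U) {ε : ℝ} (hε : 0 < ε)
    {x : Euc n} (hx : closedBall x (2 * ε) ⊆ U) :
    AscendsAt (fun y z => dist y z ≤ ε) (ballMax ε u) x := by
  obtain ⟨w, hw, hmax⟩ := (isCompact_closedBall x (2 * ε)).exists_isMaxOn
    ⟨x, mem_closedBall_self (by linarith)⟩ (hu.mono hx)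
  have hsub : ∀ y, dist x y ≤ ε → closedBall y ε ⊆ closedBall x (2 * ε) := fun y hy =>
    closedBall_subset_closedBall' (by rw [dist_comm y x]; linarith)
  have hcont : ∀ y, dist x y ≤ ε → ContinuousOn u (closedBall y ε) := fun y hy =>
    hu.mono ((hsub y hy).trans hx)
  rw [mem_closedBall] at hw
  have hz1 : dist x (midpoint ℝ x w) ≤ ε := by
    rw [dist_left_midpoint, dist_comm x w, Real.norm_ofNat]
    linarith
  have hz2 : w ∈ closedBall (midpoint ℝ x w) ε := by
    rw [mem_closedBall, dist_comm, dist_midpoint_right, dist_comm x w, Real.norm_ofNat]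
    linarith
  have hzw := le_ballMax (hcont _ hz1) hz2
  refine ⟨midpoint ℝ x w, hz1, fun y hy => ?_, fun y hy => ?_⟩
  · obtain ⟨q, hq, hqe⟩ := exists_eq_ballMax hε.le (hcont y hy)
    rw [hqe]
    exact (hmax (hsub y hy hq)).trans hzw
  · obtain ⟨q, hq, hqe⟩ := exists_eq_ballMax hε.le (hcont x (by simpa using hε.le))
    have h1 := h.le_of_mem_closedBall hε hx (fun z hz => hmax hz) hq
    have h2 : u x ≤ ballMax ε u y := le_ballMax (hcont y hy) hy
    linarith

/-- A subsolution with sublinear growth from above is bounded above. -/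
lemma CmpAbove.exists_forall_le (h : CmpAbove U u) (hUo : IsOpen U)
    (hfb : IsBounded (frontier U)) (hu : ContinuousOn u (closure U))
    (hgrow : ∀ ε > (0 : ℝ), ∀ᶠ x in cobounded (Euc n), u x / ‖x‖ ≤ ε) :
    ∃ C, ∀ x ∈ U, u x ≤ C := by
  obtain ⟨R₀, hR₀, hfr⟩ := hfb.subset_ball_lt 0 0
  have hK : IsCompact (closure U ∩ closedBall 0 R₀) :=
    (isCompact_closedBall _ _).inter_left isClosed_closure
  obtain ⟨C₀, hC₀⟩ := (hK.image_of_continuousOn (hu.mono inter_subset_left)).bddAbove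
  have hC : ∀ x ∈ U, ‖x‖ ≤ R₀ → u x ≤ max C₀ 0 := fun x hx hxR =>
    (hC₀ ⟨x, ⟨subset_closure hx, by simpa using hxR⟩, rfl⟩).trans (le_max_left _ _)
  refine ⟨max C₀ 0, fun x hx => ?_⟩
  rcases le_or_gt ‖x‖ R₀ with hxR | hxR
  · exact hC x hx hxR
  have key : ∀ ε > 0, u x ≤ ε * ‖x‖ + max C₀ 0 := by
    intro ε hε
    obtain ⟨R₁, -, hR₁⟩ := (hasBasis_cobounded_norm (E := Euc n)).eventually_iff.1 (hgrow ε hε)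
    set R := max (‖x‖ + 1) R₁
    have hxR' : ‖x‖ < R := (lt_add_one _).trans_le (le_max_left _ _)
    set V : Set (Euc n) := U ∩ (ball 0 R \ closedBall 0 R₀)
    have hVo : IsOpen V := hUo.inter (isOpen_ball.sdiff isClosed_closedBall)
    have hcl : ∀ y ∈ closure V, y ∈ closure U ∧ ‖y‖ ≤ R ∧ R₀ ≤ ‖y‖ := by
      intro y hy
      refine ⟨closure_mono inter_subset_left hy, ?_⟩
      have hc : IsClosed {z : Euc n | ‖z‖ ≤ R ∧ R₀ ≤ ‖z‖} :=
        (isClosed_le continuous_norm continuous_const).inter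
          (isClosed_le continuous_const continuous_norm)
      refine closure_minimal (fun z hz => ?_) hc hy
      have h1 := hz.2.1
      have h2 := hz.2.2
      simp only [mem_ball_zero_iff, mem_closedBall_zero_iff, not_le] at h1 h2
      exact ⟨h1.le, h2.le⟩
    have hclU : closure V ⊆ U := by
      intro y hy
      obtain ⟨h1, -, h3⟩ := hcl y hy
      by_contra hyU
      have : y ∈ frontier U := by
        rw [hUo.frontier_eq]
        exact ⟨h1, hyU⟩
      have := hfr this
      rw [mem_ball_zero_iff] at this
      linarith
    have hV0 : V \ {0} = V := by
      refine sdiff_singleton_eq_self fun h0 => h0.2.2 ?_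
      simpa using hR₀.le
    have := h V hVo (isBounded_ball.subset fun y hy => hy.2.1) hclU 0 ε (max C₀ 0) ?_ x
      ⟨hx, by simpa using hxR', by simpa using hxR⟩
    · simpa using this
    · intro y hy
      rw [hV0, hVo.frontier_eq] at hy
      obtain ⟨-, h2, h3⟩ := hcl y hy.1
      have hyU := hclU hy.1
      rw [sub_zero]
      have hpos : 0 ≤ ε * ‖y‖ := by positivity
      rcases h3.eq_or_lt with h3 | h3
      · linarith [hC y hyU h3.ge]
      rcases h2.eq_or_lt with h2 | h2
      · have h4 := hR₁ (show y ∈ {x : Euc n | R₁ ≤ ‖x‖} from (le_max_right _ _).trans h2.ge)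
        rw [div_le_iff₀ (by linarith)] at h4
        linarith [le_max_right C₀ 0]
      · exact absurd ⟨hyU, by simpa using h2, by simpa using h3⟩ hy.2
  have hlim : Tendsto (fun ε : ℝ => ε * ‖x‖ + max C₀ 0) (𝓝[>] 0) (𝓝 (max C₀ 0)) := by
    have : Continuous fun ε : ℝ => ε * ‖x‖ + max C₀ 0 := by fun_prop
    simpa using (this.tendsto 0).mono_left nhdsWithin_le_nhds
  exact ge_of_tendsto hlim (eventually_mem_nhdsWithin.mono fun ε hε => key ε hε)

lemma exists_forall_frontier_dist_lt (hfb : IsBounded (frontier U))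
    (hu : ContinuousOn u (closure U)) {η : ℝ} (hη : 0 < η) :
    ∃ δ > 0, ∀ p ∈ frontier U, ∀ y ∈ closure U, dist y p < δ → |u y - u p| < η := by
  obtain ⟨R, hfr⟩ := hfb.subset_closedBall 0
  have hK : IsCompact (closure U ∩ closedBall 0 (R + 1)) :=
    (isCompact_closedBall _ _).inter_left isClosed_closure
  obtain ⟨δ, hδ, h⟩ := Metric.uniformContinuousOn_iff.1
    (hK.uniformContinuousOn_of_continuous (hu.mono inter_subset_left)) η hη
  refine ⟨min δ 1, lt_min hδ one_pos, fun p hp y hy hyp => ?_⟩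
  have hpR := hfr hp
  rw [mem_closedBall] at hpR
  refine h y ⟨hy, ?_⟩ p ⟨frontier_subset_closure hp, ?_⟩ (hyp.trans_le (min_le_left _ _))
  · rw [mem_closedBall]
    linarith [dist_triangle y p 0, min_le_right δ 1]
  · rw [mem_closedBall]
    linarith

lemma exists_mem_frontier_dist_le {ε : ℝ} {x : Euc n} (hx : x ∈ U) (h : ¬ closedBall x ε ⊆ U) :
    ∃ p ∈ frontier U, dist x p ≤ ε := by
  obtain ⟨w, hw, hwU⟩ := not_subset.1 h
  obtain ⟨p, hp, hpe⟩ := exists_mem_frontier_infDist_compl_eq_dist hx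
    (fun h => hwU (h ▸ mem_univ w))
  refine ⟨p, hp, hpe ▸ (infDist_le_dist_of_mem hwU).trans ?_⟩
  rwa [dist_comm]

lemma exists_dist_le_ceil_lt {ε : ℝ} (hε : 0 < ε) {x p : Euc n} (h : ε < dist x p) :
    ∃ y, dist x y ≤ ε ∧ ⌈dist y p / ε⌉₊ < ⌈dist x p / ε⌉₊ := by
  have hd : 0 < dist x p := hε.trans h
  refine ⟨AffineMap.lineMap x p (ε / dist x p), ?_, ?_⟩
  · rw [dist_left_lineMap, Real.norm_of_nonneg (by positivity), div_mul_cancel₀ _ hd.ne']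
  · have h1 : dist (AffineMap.lineMap x p (ε / dist x p)) p = dist x p - ε := by
      rw [dist_lineMap_right, Real.norm_of_nonneg, sub_mul, div_mul_cancel₀ _ hd.ne', one_mul]
      rw [sub_nonneg, div_le_one hd]
      exact h.le
    have h2 : dist x p / ε = (dist x p - ε) / ε + 1 := by
      field_simp
      ring
    rw [h1, h2, Nat.ceil_add_one (div_nonneg (by linarith) hε.le)]
    exact Nat.lt_succ_self _

end Continuous

/-- Theorem 5, [CGW07]: exterior comparison principle. -/
theorem stmt10 {n : ℕ} (U : Set (Euc n)) (hUo : IsOpen U) (hUub : ¬ IsBounded U)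
    (hfb : IsBounded (frontier U)) (hfne : (frontier U).Nonempty)
    (u v : Euc n → ℝ) (hu : ContinuousOn u (closure U)) (hv : ContinuousOn v (closure U))
    (hua : CmpAbove U u) (hvb : CmpBelow U v)
    (hgrowu : ∀ ε > (0 : ℝ), ∀ᶠ x in cobounded (Euc n), u x / ‖x‖ ≤ ε)
    (hgrowv : ∀ ε > (0 : ℝ), ∀ᶠ x in cobounded (Euc n), -ε ≤ v x / ‖x‖) :
    ∀ x ∈ U, u x - v x ≤ sSup ((fun y => u y - v y) '' frontier U) := by
  intro x hx
  set m := sSup ((fun y => u y - v y) '' frontier U)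
  have hmle : ∀ p ∈ frontier U, u p - v p ≤ m := by
    have hK : IsCompact (frontier U) := isCompact_of_isClosed_isBounded isClosed_frontier hfb
    exact fun p hp => le_csSup (hK.image_of_continuousOn
      ((hu.sub hv).mono frontier_subset_closure)).bddAbove ⟨p, hp, rfl⟩
  have hva := hvb.neg
  have hvc : ContinuousOn (fun y => -v y) (closure U) := hv.neg
  obtain ⟨C, hC⟩ := hua.exists_forall_le hUo hfb hu hgrowu
  obtain ⟨c, hc⟩ := hva.exists_forall_le hUo hfb hvc fun ε hε =>
    (hgrowv ε hε).mono fun y hy => by rw [neg_div]; linarith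
  obtain ⟨p₀, hp₀⟩ := hfne
  have hp₀U : p₀ ∉ U := by
    rw [hUo.frontier_eq] at hp₀
    exact hp₀.2
  refine le_of_forall_pos_le_add fun η hη => ?_
  obtain ⟨δ₁, hδ₁, hu'⟩ := exists_forall_frontier_dist_lt hfb hu (half_pos hη)
  obtain ⟨δ₂, hδ₂, hv'⟩ := exists_forall_frontier_dist_lt hfb hvc (half_pos hη)
  obtain ⟨δ₃, hδ₃, hxU⟩ := Metric.nhds_basis_closedBall.mem_iff.1 (hUo.mem_nhds hx)
  set ε := min (min δ₁ δ₂ / 4) δ₃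
  have hε : 0 < ε := lt_min (by have := lt_min hδ₁ hδ₂; positivity) hδ₃
  have hεδ : 4 * ε ≤ min δ₁ δ₂ := by linarith [min_le_left (min δ₁ δ₂ / 4) δ₃]
  have hε₁ : 4 * ε ≤ δ₁ := hεδ.trans (min_le_left _ _)
  have hε₂ : 4 * ε ≤ δ₂ := hεδ.trans (min_le_right _ _)
  have huU := hu.mono subset_closure
  have hvU := hvc.mono subset_closure
  set D : Set (Euc n) := {y | closedBall y ε ⊆ U}
  have hxD : x ∈ D := (closedBall_subset_closedBall (min_le_right _ _)).trans hxU
  have main := sub_le_of_ascendsAt (r := fun y z : Euc n => dist y z ≤ ε)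
    (I := {y | closedBall y (2 * ε) ⊆ U}) (D := D) (f := ballMax ε u)
    (g := fun y => -ballMax ε (fun z => -v z) y) (c := -c) (C := C) (m := m + η)
    (fun y z h => by rwa [dist_comm])
    (fun y hy z hyz => (closedBall_subset_closedBall'
      (by rw [dist_comm z y]; linarith)).trans hy)
    (fun y => ⌈dist y p₀ / ε⌉₊) (fun y hy => exists_dist_le_ceil_lt hε ?_)
    (fun y hy => hua.ascendsAt_ballMax huU hε hy)
    (fun y hy => by simpa only [neg_neg] using hva.ascendsAt_ballMax hvU hε hy)
    (fun y hy => ?_) (fun y hy => ?_) (fun y hy hyI => ?_) hxD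
  · have h1 := le_ballMax (huU.mono hxD) (mem_closedBall_self hε.le)
    have h2 := le_ballMax (hvU.mono hxD) (mem_closedBall_self hε.le)
    linarith
  · by_contra! hle
    exact hp₀U (hy (by rw [mem_closedBall, dist_comm]; linarith))
  · obtain ⟨q, hq, hqe⟩ := exists_eq_ballMax hε.le (huU.mono hy)
    rw [hqe]
    exact hC q (hy hq)
  · obtain ⟨q, hq, hqe⟩ := exists_eq_ballMax hε.le (hvU.mono hy)
    rw [hqe]
    exact neg_le_neg (hc q (hy hq))
  · obtain ⟨p, hp, hyp⟩ := exists_mem_frontier_dist_le (hy (mem_closedBall_self hε.le)) hyI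
    obtain ⟨q₁, hq₁, hqe₁⟩ := exists_eq_ballMax hε.le (huU.mono hy)
    obtain ⟨q₂, hq₂, hqe₂⟩ := exists_eq_ballMax hε.le (hvU.mono hy)
    rw [hqe₁, hqe₂]
    have hd₁ : dist q₁ p < δ₁ := by linarith [dist_triangle q₁ y p, mem_closedBall.1 hq₁]
    have hd₂ : dist q₂ p < δ₂ := by linarith [dist_triangle q₂ y p, mem_closedBall.1 hq₂]
    have h₁ := (abs_lt.1 (hu' p hp q₁ (subset_closure (hy hq₁)) hd₁)).2
    have h₂ := (abs_lt.1 (hv' p hp q₂ (subset_closure (hy hq₂)) hd₂)).2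
    linarith [hmle p hp]
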